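/- Write the Furstenberg set S = {s₁ < s₂ < ⋯}. Then s_n ~ exp(C√n)/√6 as n → ∞, where C = √(2·log 2·log 3); in particular log s_n ~ C√n. -/

import Mathlib

open Filter Real

lemma perm_sum (q : ℕ) (p m : ℤ) (hq : 0 < q) (hc : IsCoprime p (q:ℤ)) :
    ∑ k ∈ Finset.range q, ((m - k * p) % (q:ℤ)) = ∑ k ∈ Finset.range q, (k:ℤ) := by
  have hq' : (0:ℤ) < q := by exact_mod_cast hq
  have hinj : Set.InjOn (fun k : ℕ => ((m - k * p) % (q:ℤ)).toNat) (Finset.range q : Set ℕ) := by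
    intro i hi j hj h
    simp only [Finset.coe_range, Set.mem_Iio] at hi hj
    have h1 := Int.emod_nonneg (m - i * p) hq'.ne'
    have h2 := Int.emod_nonneg (m - j * p) hq'.ne'
    have h3 : (m - i * p) % (q:ℤ) = (m - j * p) % (q:ℤ) := by
      simp only at h
      omega
    have h4 : (q:ℤ) ∣ (m - j * p) - (m - i * p) := Int.ModEq.dvd h3
    have h5 : (q:ℤ) ∣ ((i:ℤ) - j) * p := by
      convert h4 using 1; ring
    have h6 : (q:ℤ) ∣ (i:ℤ) - j := hc.symm.dvd_of_dvd_mul_right h5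
    have h7 : (i:ℤ) - j = 0 := Int.eq_zero_of_abs_lt_dvd h6 (by rw [abs_lt]; omega)
    omega
  have himg : (Finset.range q).image (fun k : ℕ => ((m - k * p) % (q:ℤ)).toNat) = Finset.range q := by
    apply Finset.eq_of_subset_of_card_le
    · intro x hx
      simp only [Finset.mem_image, Finset.mem_range] at hx ⊢
      obtain ⟨k, hk, rfl⟩ := hx
      have h1 := Int.emod_nonneg (m - k * p) hq'.ne'
      have h2 := Int.emod_lt_of_pos (m - k * p) hq'
      omega
    · rw [Finset.card_image_of_injOn hinj]
  conv_rhs => rw [← himg]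
  rw [Finset.sum_image hinj]
  apply Finset.sum_congr rfl
  intro k hk
  have h1 := Int.emod_nonneg (m - k * p) hq'.ne'
  omega

lemma sum_range_real (q : ℕ) : ∑ k ∈ Finset.range q, (k:ℝ) = (q:ℝ) * (q - 1) / 2 := by
  induction q with
  | zero => simp
  | succ n ih => rw [Finset.sum_range_succ, ih]; push_cast; ring

lemma div_sum (q : ℕ) (p m : ℤ) (hq : 0 < q) (hc : IsCoprime p (q:ℤ)) :
    ∑ k ∈ Finset.range q, (((m - k * p) / (q:ℤ) : ℤ) : ℝ)
      = ∑ k ∈ Finset.range q, ((m:ℝ) / q - k * (p / q)) - ((q:ℝ) - 1) / 2 := by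
  have hq' : (0:ℝ) < q := by exact_mod_cast hq
  have h1 : ∀ k : ℕ, (((m - k * p) / (q:ℤ) : ℤ) : ℝ)
      = ((m:ℝ) / q - k * (p / q)) - (((m - k * p) % (q:ℤ) : ℤ) : ℝ) / q := by
    intro k
    have := Int.emod_add_mul_ediv (m - k * p) q
    have h : ((((m - k * p) % (q:ℤ) : ℤ) : ℝ)) + q * (((m - k * p) / (q:ℤ) : ℤ) : ℝ) = m - k * p := by
      exact_mod_cast this
    field_simp
    linarith
  simp_rw [h1]
  rw [Finset.sum_sub_distrib, ← Finset.sum_div, ← Int.cast_sum, perm_sum q p m hq hc]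
  push_cast
  rw [sum_range_real]
  congr 1
  field_simp

lemma block (α : ℝ) (q : ℕ) (p : ℤ) (hq : 0 < q) (hc : IsCoprime p (q:ℤ))
    (h : |α - p / q| ≤ 1 / (q:ℝ) ^ 2) (x : ℝ) :
    |∑ k ∈ Finset.range q, ((⌊x - k * α⌋ : ℝ) - (x - k * α) + 1 / 2)| ≤ 3 := by
  have hq' : (0:ℝ) < q := by exact_mod_cast hq
  have hqz : (0:ℤ) < q := by exact_mod_cast hq
  have hk : ∀ k ∈ Finset.range q, |k * α - k * (p / q)| ≤ 1 / (q:ℝ) := by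
    intro k hk
    have hk' : (k:ℝ) ≤ q := by exact_mod_cast (Finset.mem_range.1 hk).le
    rw [← mul_sub, abs_mul, Nat.abs_cast]
    calc (k:ℝ) * |α - p / q| ≤ q * (1 / (q:ℝ) ^ 2) := by gcongr
      _ = 1 / q := by field_simp
  rw [abs_le]
  constructor
  · set m := ⌊(q:ℝ) * (x - 1 / q)⌋ with hm
    have hm1 : (m:ℝ) ≤ q * (x - 1 / q) := Int.floor_le _
    have hm2 : q * (x - 1 / q) < (m:ℝ) + 1 := Int.lt_floor_add_one _
    have e1 : x - 1 / q - 1 / q ≤ (m:ℝ) / q := by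
      rw [le_div_iff₀ hq']
      have : (x - 1 / q - 1 / q) * (q:ℝ) = q * (x - 1 / q) - 1 := by field_simp
      linarith
    have e2 : (m:ℝ) / q ≤ x - 1 / q := by
      rw [div_le_iff₀ hq']; linarith
    have key : ∀ k ∈ Finset.range q, (((m - k * p) / (q:ℤ) : ℤ) : ℝ)
        - ((m:ℝ) / q - k * (p / q)) - 3 / q + 1 / 2 ≤ (⌊x - k * α⌋ : ℝ) - (x - k * α) + 1 / 2 := by
      intro k hkk
      have h1 := abs_le.1 (hk k hkk)
      have h2 : (m - k * p) / (q:ℤ) ≤ ⌊x - k * α⌋ := by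
        rw [Int.le_floor]
        have h3 : ((m - k * p) / (q:ℤ)) * q ≤ m - k * p := Int.ediv_mul_le _ hqz.ne'
        have h4 : (((m - k * p) / (q:ℤ) : ℤ) : ℝ) * q ≤ m - k * p := by exact_mod_cast h3
        rw [← le_div_iff₀ hq'] at h4
        have : ((m:ℝ) - k * p) / q = m / q - k * (p / q) := by ring
        linarith
      have h3 : (((m - k * p) / (q:ℤ) : ℤ) : ℝ) ≤ ⌊x - k * α⌋ := by exact_mod_cast h2
      have h5 : (3:ℝ) / q = 1 / q + 1 / q + 1 / q := by ring
      linarith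
    refine le_trans ?_ (Finset.sum_le_sum key)
    simp only [Finset.sum_add_distrib, Finset.sum_sub_distrib]
    rw [div_sum q p m hq hc]
    simp only [Finset.sum_sub_distrib, Finset.sum_const, Finset.card_range, nsmul_eq_mul]
    have : (q:ℝ) * (3 / q) = 3 := by field_simp
    linarith
  · set m := ⌊(q:ℝ) * (x + 1 / q)⌋ with hm
    have hm1 : (m:ℝ) ≤ q * (x + 1 / q) := Int.floor_le _
    have e2 : (m:ℝ) / q ≤ x + 1 / q := by
      rw [div_le_iff₀ hq']; linarith
    have key : ∀ k ∈ Finset.range q, (⌊x - k * α⌋ : ℝ) - (x - k * α) + 1 / 2 ≤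
        (((m - k * p) / (q:ℤ) : ℤ) : ℝ) - ((m:ℝ) / q - k * (p / q)) + 2 / q + 1 / 2 := by
      intro k hkk
      have h1 := abs_le.1 (hk k hkk)
      have h2 : ⌊x - k * α⌋ ≤ (m - k * p) / (q:ℤ) := by
        rw [Int.le_ediv_iff_mul_le hqz]
        suffices ⌊x - k * α⌋ * (q:ℤ) + k * p ≤ m by linarith
        rw [hm, Int.le_floor]
        push_cast
        have h3 := Int.floor_le (x - k * α)
        have h4 : (⌊x - k * α⌋ : ℝ) * q ≤ (x + 1 / q - k * (p / q)) * q := by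
          gcongr
          linarith
        have : (x + 1 / q - k * (p / q)) * q = q * (x + 1 / q) - k * p := by field_simp
        linarith
      have h3 : (⌊x - k * α⌋ : ℝ) ≤ (((m - k * p) / (q:ℤ) : ℤ) : ℝ) := by exact_mod_cast h2
      have h5 : (2:ℝ) / q = 1 / q + 1 / q := by ring
      linarith
    refine le_trans (Finset.sum_le_sum key) ?_
    simp only [Finset.sum_add_distrib, Finset.sum_sub_distrib]
    rw [div_sum q p m hq hc]
    simp only [Finset.sum_sub_distrib, Finset.sum_const, Finset.card_range, nsmul_eq_mul]
    have : (q:ℝ) * (2 / q) = 2 := by field_simp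
    linarith

lemma g_abs (t : ℝ) : |(⌊t⌋ : ℝ) - t + 1 / 2| ≤ 1 := by
  have h1 := Int.floor_le t
  have h2 := Int.lt_floor_add_one t
  rw [abs_le]; constructor <;> linarith

lemma blocks (α : ℝ) (q : ℕ) (p : ℤ) (hq : 0 < q) (hc : IsCoprime p (q:ℤ))
    (h : |α - p / q| ≤ 1 / (q:ℝ) ^ 2) (K : ℕ) : ∀ x : ℝ,
    |∑ k ∈ Finset.range K, ((⌊x - k * α⌋ : ℝ) - (x - k * α) + 1 / 2)| ≤ 3 / q * K + q := by
  have hq' : (0:ℝ) < q := by exact_mod_cast hq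
  induction K using Nat.strong_induction_on with
  | _ K ih =>
    intro x
    by_cases hK : K < q
    · refine (Finset.abs_sum_le_sum_abs _ _).trans ?_
      refine (Finset.sum_le_sum (fun k _ => g_abs _)).trans ?_
      simp only [Finset.sum_const, Finset.card_range, nsmul_eq_mul, mul_one]
      have : (K:ℝ) ≤ q := by exact_mod_cast hK.le
      have : 0 ≤ 3 / (q:ℝ) * K := by positivity
      linarith
    · push Not at hK
      obtain ⟨r, rfl⟩ := Nat.exists_eq_add_of_le hK
      rw [Finset.sum_range_add]
      refine (abs_add_le _ _).trans ?_
      have h1 := block α q p hq hc h x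
      have h2 := ih r (by omega) (x - q * α)
      have h3 : ∀ k : ℕ, x - ((q + k : ℕ) : ℝ) * α = x - q * α - k * α := by
        intro k; push_cast; ring
      simp_rw [h3]
      have : 3 / (q:ℝ) * ((q + r : ℕ) : ℝ) + q = 3 + (3 / q * r + q) := by
        push_cast; field_simp; ring
      linarith

lemma equi (α : ℝ) (hα : Irrational α) (ε : ℝ) (hε : 0 < ε) : ∃ C : ℝ, 0 ≤ C ∧ ∀ (K : ℕ) (x : ℝ),
    |∑ k ∈ Finset.range K, ((⌊x - k * α⌋ : ℝ) - (x - k * α) + 1 / 2)| ≤ ε * K + C := by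
  obtain ⟨n, hn⟩ := exists_nat_gt (3 / ε)
  have hinf := Real.infinite_rat_abs_sub_lt_one_div_den_sq_of_irrational hα
  -- finitely many with small denominators
  have hex : ∃ r : ℚ, |α - r| < 1 / (r.den : ℝ) ^ 2 ∧ n < r.den := by
    by_contra hcon
    push Not at hcon
    apply hinf
    have hfin : (((Finset.Icc ⌊(-(n * (|α| + 1)) : ℝ)⌋ ⌈((n * (|α| + 1)) : ℝ)⌉) ×ˢ Finset.range (n+1)).image
      (fun z : ℤ × ℕ => (z.1 : ℚ) / z.2) : Set ℚ).Finite := Finset.finite_toSet _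
    refine hfin.subset ?_
    intro r hr
    have hd := hcon r hr
    have hr' : |α - r| < 1 / (r.den : ℝ) ^ 2 := hr
    have hdp : (1:ℝ) ≤ r.den := by exact_mod_cast r.pos
    have h1 : |α - r| < 1 := hr'.trans_le (by
      rw [div_le_one (by positivity)]; nlinarith)
    have h2 : |(r:ℝ)| ≤ |α| + 1 := by
      have := abs_sub_abs_le_abs_sub (r:ℝ) α
      rw [abs_sub_comm] at this; linarith
    have h3 : (r.num : ℝ) = r * r.den := by
      exact_mod_cast (Rat.mul_den_eq_num r).symm
    have h4 : |(r.num : ℝ)| ≤ n * (|α| + 1) := by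
      rw [h3, abs_mul, Nat.abs_cast, mul_comm]
      have : (r.den : ℝ) ≤ n := by exact_mod_cast hd
      gcongr
    have h5 := abs_le.1 h4
    simp only [Finset.coe_image, Set.mem_image]
    refine ⟨(r.num, r.den), ?_, Rat.num_div_den r⟩
    simp only [Finset.mem_coe, Finset.mem_product, Finset.mem_Icc, Finset.mem_range]
    refine ⟨⟨?_, ?_⟩, by omega⟩
    · have := (Int.floor_le (-(n * (|α| + 1)) : ℝ)).trans h5.1
      exact_mod_cast this
    · have := h5.2.trans (Int.le_ceil _)
      exact_mod_cast this
  obtain ⟨r, hr, hrn⟩ := hex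
  have hdp : (0:ℝ) < r.den := by exact_mod_cast r.pos
  refine ⟨r.den, hdp.le, fun K x => ?_⟩
  have hb := blocks α r.den r.num r.pos (by
    rw [Int.isCoprime_iff_gcd_eq_one]; exact r.reduced) (by
    have : ((r.num:ℝ) / r.den) = r := by exact_mod_cast Rat.num_div_den r
    rw [this]; exact hr.le) K x
  refine hb.trans ?_
  gcongr
  rw [div_le_iff₀ hdp]
  rw [div_lt_iff₀ hε] at hn
  have : (n:ℝ) < r.den := by exact_mod_cast hrn
  nlinarith

lemma irr : Irrational (Real.log 3 / Real.log 2) := by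
  have ha : 0 < Real.log 2 := Real.log_pos (by norm_num)
  have hb : 0 < Real.log 3 := Real.log_pos (by norm_num)
  rintro ⟨r, hr⟩
  have hd : (0:ℝ) < r.den := by exact_mod_cast r.pos
  have hrpos : (0:ℝ) < r := by rw [hr]; positivity
  have hrpos' : 0 < r := by exact_mod_cast hrpos
  obtain ⟨u, hu⟩ := Int.eq_ofNat_of_zero_le (Rat.num_pos.2 hrpos').le
  have h1 : ((r.num:ℝ) / r.den) = r := by exact_mod_cast Rat.num_div_den r
  rw [hu, hr] at h1
  push_cast at h1
  rw [div_eq_div_iff hd.ne' ha.ne'] at h1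
  have h2 : Real.log ((2:ℝ) ^ u) = Real.log ((3:ℝ) ^ r.den) := by
    rw [Real.log_pow, Real.log_pow]; linarith
  have h3 : ((2:ℝ) ^ u) = ((3:ℝ) ^ r.den) :=
    Real.log_injOn_pos (by simp) (by simp) h2
  have h4 : 2 ^ u = 3 ^ r.den := by exact_mod_cast h3
  have hu0 : u ≠ 0 := by
    rintro rfl
    have := Rat.num_pos.2 hrpos'
    simp [hu] at this
  have h5 : Even (2 ^ u) := by simp [Nat.even_pow, hu0]
  have h6 : Odd (3 ^ r.den) := Odd.pow (by decide)
  rw [← h4] at h6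
  exact (Nat.not_even_iff_odd.2 h6) h5

lemma unique23 {j k j' k' : ℕ} (h : 2 ^ j * 3 ^ k = 2 ^ j' * 3 ^ k') : j = j' ∧ k = k' := by
  have h2 := congrArg (fun n => n.factorization 2) h
  have h3 := congrArg (fun n => n.factorization 3) h
  have e2 : Nat.factorization 2 = Finsupp.single 2 1 := Nat.Prime.factorization Nat.prime_two
  have e3 : Nat.factorization 3 = Finsupp.single 3 1 := Nat.Prime.factorization Nat.prime_three
  simp [Nat.factorization_mul, Nat.factorization_pow, e2, e3] at h2 h3
  exact ⟨h2, h3⟩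

open Classical in
lemma count_eq (N : ℕ) (hN : 1 ≤ N) :
    (Nat.count (fun m : ℕ => ∃ j k : ℕ, m = 2 ^ j * 3 ^ k) (N + 1) : ℝ) =
    ∑ k ∈ Finset.range (⌊Real.log N / Real.log 3⌋₊ + 1),
      ((⌊Real.log N / Real.log 2 - k * (Real.log 3 / Real.log 2)⌋ : ℝ) + 1) := by
  have ha : 0 < Real.log 2 := Real.log_pos (by norm_num)
  have hb : 0 < Real.log 3 := Real.log_pos (by norm_num)
  have hN' : (0:ℝ) < N := by exact_mod_cast hN
  have hL : 0 ≤ Real.log N := Real.log_nonneg (by exact_mod_cast hN)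
  have hle : ∀ j k : ℕ, 2 ^ j * 3 ^ k ≤ N ↔ j * Real.log 2 + k * Real.log 3 ≤ Real.log N := by
    intro j k
    rw [← Real.log_pow, ← Real.log_pow, ← Real.log_mul (by positivity) (by positivity),
      Real.log_le_log_iff (by positivity) hN']
    exact_mod_cast Iff.rfl
  set y : ℕ → ℝ := fun k => Real.log N / Real.log 2 - k * (Real.log 3 / Real.log 2) with hy
  have hya : ∀ k, y k * Real.log 2 = Real.log N - k * Real.log 3 := by
    intro k; simp only [hy]; field_simp
  have hcard : Nat.count (fun m : ℕ => ∃ j k : ℕ, m = 2 ^ j * 3 ^ k) (N + 1) =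
      ((Finset.range (⌊Real.log N / Real.log 3⌋₊ + 1)).sigma
        (fun k => Finset.range (⌊y k⌋₊ + 1))).card := by
    rw [Nat.count_eq_card_filter_range]
    symm
    apply Finset.card_bij (fun (z : Σ _ : ℕ, ℕ) _ => 2 ^ z.2 * 3 ^ z.1)
    · rintro ⟨k, j⟩ hz
      simp only [Finset.mem_sigma, Finset.mem_range, Finset.mem_filter] at hz ⊢
      refine ⟨?_, j, k, rfl⟩
      rw [Nat.lt_succ_iff, hle]
      obtain ⟨h1, h2⟩ := hz
      rw [Nat.lt_succ_iff, Nat.le_floor_iff (by positivity), le_div_iff₀ hb] at h1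
      have hy0 : 0 ≤ y k := by
        have := hya k
        by_contra hc
        push Not at hc
        nlinarith
      rw [Nat.lt_succ_iff, Nat.le_floor_iff hy0] at h2
      have := mul_le_mul_of_nonneg_right h2 ha.le
      rw [hya] at this
      linarith
    · rintro ⟨k, j⟩ _ ⟨k', j'⟩ _ h
      obtain ⟨rfl, rfl⟩ := unique23 h
      rfl
    · intro m hm
      simp only [Finset.mem_range, Finset.mem_filter] at hm
      obtain ⟨h1, j, k, rfl⟩ := hm
      rw [Nat.lt_succ_iff, hle] at h1
      refine ⟨⟨k, j⟩, ?_, rfl⟩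
      simp only [Finset.mem_sigma, Finset.mem_range]
      have hj : 0 ≤ j * Real.log 2 := by positivity
      have hk : 0 ≤ k * Real.log 3 := by positivity
      constructor
      · rw [Nat.lt_succ_iff, Nat.le_floor_iff (by positivity), le_div_iff₀ hb]
        linarith
      · rw [Nat.lt_succ_iff]
        apply Nat.le_floor
        have := hya k
        by_contra hc
        push Not at hc
        nlinarith
  rw [hcard, Finset.card_sigma]
  push_cast
  apply Finset.sum_congr rfl
  intro k hk
  rw [Finset.card_range]
  push_cast
  congr 1
  rw [Finset.mem_range, Nat.lt_succ_iff, Nat.le_floor_iff (by positivity), le_div_iff₀ hb] at hk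
  have hy0 : 0 ≤ y k := by
    have := hya k
    by_contra hc
    push Not at hc
    nlinarith
  exact natCast_floor_eq_intCast_floor hy0

set_option maxHeartbeats 1000000 in
open Classical in
lemma count_est (ε : ℝ) (hε : 0 < ε) : ∃ C : ℝ, ∀ N : ℕ, 1 ≤ N →
    |2 * Real.log 2 * Real.log 3 * (Nat.count (fun m : ℕ => ∃ j k : ℕ, m = 2 ^ j * 3 ^ k) (N + 1) : ℝ)
      - (Real.log N + (Real.log 2 + Real.log 3) / 2) ^ 2| ≤ ε * Real.log N + C := by
  have ha : 0 < Real.log 2 := Real.log_pos (by norm_num)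
  have hb : 0 < Real.log 3 := Real.log_pos (by norm_num)
  obtain ⟨C, hC0, hC⟩ := equi _ irr (ε / (2 * Real.log 2)) (by positivity)
  refine ⟨2 * Real.log 2 * Real.log 3 * (ε / (2 * Real.log 2) + C) + (Real.log 2 * Real.log 3 + Real.log 3 ^ 2
    + ((Real.log 2 + Real.log 3) / 2) ^ 2), fun N hN => ?_⟩
  have hL : 0 ≤ Real.log N := Real.log_nonneg (by exact_mod_cast hN)
  rw [count_eq N hN]
  have hK1 := Nat.lt_floor_add_one (Real.log N / Real.log 3)
  have hK2 := Nat.floor_le (a := Real.log N / Real.log 3) (by positivity)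
  set F := ⌊Real.log N / Real.log 3⌋₊
  have h := hC (F + 1) (Real.log N / Real.log 2)
  set L := Real.log N
  set a := Real.log 2
  set b := Real.log 3
  set E := ∑ k ∈ Finset.range (F + 1), ((⌊L / a - k * (b / a)⌋ : ℝ) - (L / a - k * (b / a)) + 1 / 2) with hE
  have hsum : ∑ k ∈ Finset.range (F + 1), ((⌊L / a - k * (b / a)⌋ : ℝ) + 1)
      = E + ((F + 1) * (L / a + 1 / 2) - (b / a) * ((F + 1) * F / 2)) := by
    have : ∀ k : ℕ, ((⌊L / a - k * (b / a)⌋ : ℝ) + 1) =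
      ((⌊L / a - k * (b / a)⌋ : ℝ) - (L / a - k * (b / a)) + 1 / 2) + ((L / a + 1 / 2) - k * (b / a)) := by
      intro k; ring
    rw [Finset.sum_congr rfl (fun k _ => this k), Finset.sum_add_distrib, ← hE, Finset.sum_sub_distrib,
      ← Finset.sum_mul, sum_range_real]
    simp only [Finset.sum_const, Finset.card_range, nsmul_eq_mul]
    push_cast
    ring
  rw [hsum]
  obtain ⟨t, ht⟩ : ∃ t : ℝ, t = F + 1 - L / b := ⟨_, rfl⟩
  have ht0 : 0 ≤ t := by linarith
  have ht1 : t ≤ 1 := by linarith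
  have hF : (F:ℝ) = L / b + t - 1 := by linarith
  have e : 2 * a * b * (E + ((F + 1) * (L / a + 1 / 2) - (b / a) * ((F + 1) * F / 2))) - (L + (a + b) / 2) ^ 2
      = 2 * a * b * E + (a * b * t + b ^ 2 * (t - t ^ 2) - ((a + b) / 2) ^ 2) := by
    rw [hF]; field_simp; ring
  rw [e]
  clear e hsum hC hK1 hK2
  have hF1 : ((F + 1 : ℕ) : ℝ) ≤ L / b + 1 := by push_cast; linarith only [hF, ht1]
  have h2 : |E| ≤ ε / (2 * a) * (L / b + 1) + C := h.trans (by gcongr)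
  have h3 : |2 * a * b * E| ≤ 2 * a * b * (ε / (2 * a) * (L / b + 1) + C) := by
    rw [abs_mul, abs_of_pos (by positivity : 0 < 2 * a * b)]
    gcongr
  have e4 : 2 * a * b * (ε / (2 * a) * (L / b + 1) + C) = ε * L + 2 * a * b * (ε / (2 * a) + C) := by
    field_simp; ring
  have h5 : |a * b * t + b ^ 2 * (t - t ^ 2) - ((a + b) / 2) ^ 2| ≤ a * b + b ^ 2 + ((a + b) / 2) ^ 2 := by
    have hab : 0 < a * b := by positivity
    have hbb : 0 < b ^ 2 := by positivity
    have hcc : 0 < ((a + b) / 2) ^ 2 := by positivity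
    have u1 : a * b * t ≤ a * b := mul_le_of_le_one_right hab.le ht1
    have u2 : 0 ≤ a * b * t := by positivity
    have u3 : 0 ≤ t - t ^ 2 := by
      have : t - t ^ 2 = t * (1 - t) := by ring
      rw [this]; exact mul_nonneg ht0 (by linarith)
    have u4 : t - t ^ 2 ≤ 1 := by linarith [sq_nonneg t]
    have u5 : b ^ 2 * (t - t ^ 2) ≤ b ^ 2 := mul_le_of_le_one_right hbb.le u4
    have u6 : 0 ≤ b ^ 2 * (t - t ^ 2) := by positivity
    clear_value E a b
    rw [abs_le]; constructor <;> linarith only [u1, u2, u5, u6, hcc, hab, hbb]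
  refine (abs_add_le _ _).trans ?_
  linarith only [h3, e4, h5]

lemma inf23 : (Set.ofPred (fun m : ℕ => ∃ j k : ℕ, m = 2 ^ j * 3 ^ k)).Infinite := by
  apply Set.infinite_of_injective_forall_mem (f := fun j : ℕ => 2 ^ j)
  · exact Nat.pow_right_injective le_rfl
  · intro j; exact ⟨j, 0, by simp⟩

lemma main_lim : Tendsto (fun n : ℕ =>
    Real.log (Nat.nth (fun m : ℕ => ∃ j k : ℕ, m = 2 ^ j * 3 ^ k) n : ℝ)
      - Real.sqrt (2 * Real.log 2 * Real.log 3) * Real.sqrt n + (Real.log 2 + Real.log 3) / 2)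
    atTop (nhds 0) := by
  classical
  have ha : 0 < Real.log 2 := Real.log_pos (by norm_num)
  have hb : 0 < Real.log 3 := Real.log_pos (by norm_num)
  set s : ℕ → ℕ := Nat.nth (fun m : ℕ => ∃ j k : ℕ, m = 2 ^ j * 3 ^ k) with hs
  have hmono : StrictMono s := Nat.nth_strictMono inf23
  have hs1 : ∀ n, 1 ≤ s n := by
    intro n
    obtain ⟨j, k, h⟩ := Nat.nth_mem_of_infinite inf23 n
    change 1 ≤ Nat.nth (fun m : ℕ => ∃ j k : ℕ, m = 2 ^ j * 3 ^ k) n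
    rw [h]
    exact Nat.one_le_iff_ne_zero.2 (by positivity)
  have hcount : ∀ n, Nat.count (fun m : ℕ => ∃ j k : ℕ, m = 2 ^ j * 3 ^ k) (s n + 1) = n + 1 :=
    fun n => Nat.count_nth_succ_of_infinite inf23 n
  have hlog : Tendsto (fun n => Real.log (s n)) atTop atTop :=
    Real.tendsto_log_atTop.comp (tendsto_natCast_atTop_atTop.comp hmono.tendsto_atTop)
  set D := Real.sqrt (2 * Real.log 2 * Real.log 3) with hD
  have hDsq : D ^ 2 = 2 * Real.log 2 * Real.log 3 := Real.sq_sqrt (by positivity)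
  have hD0 : 0 ≤ D := Real.sqrt_nonneg _
  set c := (Real.log 2 + Real.log 3) / 2 with hc
  have hc0 : 0 < c := by positivity
  have h1 : Tendsto (fun n : ℕ => Real.log (s n) + c - D * Real.sqrt (n + 1)) atTop (nhds 0) := by
    rw [Metric.tendsto_nhds]
    intro ε hε
    obtain ⟨C, hC⟩ := count_est (ε / 2) (by positivity)
    filter_upwards [hlog.eventually_gt_atTop (2 * C / ε), hlog.eventually_gt_atTop 0] with n hn hn0
    have h := hC (s n) (hs1 n)
    rw [hcount n] at h
    push_cast at h
    rw [Real.dist_eq, sub_zero]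
    have hr : Real.sqrt ((n:ℝ) + 1) ^ 2 = n + 1 := Real.sq_sqrt (by positivity)
    have hr0 : 0 ≤ D * Real.sqrt ((n:ℝ) + 1) := by positivity
    have e : 2 * Real.log 2 * Real.log 3 * ((n:ℝ) + 1) - (Real.log (s n) + c) ^ 2
      = - ((Real.log (s n) + c - D * Real.sqrt (n + 1)) * (Real.log (s n) + c + D * Real.sqrt (n + 1))) := by
      rw [← hDsq]
      linear_combination (-D ^ 2) * hr
    rw [e, abs_neg, abs_mul, abs_of_pos (a := Real.log (s n) + c + D * Real.sqrt (n + 1)) (by positivity)] at h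
    rw [div_lt_iff₀ hε] at hn
    by_contra hcon
    push Not at hcon
    have h6 : ε * Real.log (s n) ≤ |Real.log (s n) + c - D * Real.sqrt (n + 1)| * (Real.log (s n) + c + D * Real.sqrt (n + 1)) := by
      gcongr
      linarith
    linarith
  have h2 : Tendsto (fun n : ℕ => D * (Real.sqrt (n + 1) - Real.sqrt n)) atTop (nhds 0) := by
    have h3 : Tendsto (fun n : ℕ => Real.sqrt n) atTop atTop :=
      Real.tendsto_sqrt_atTop.comp tendsto_natCast_atTop_atTop
    have h4 : Tendsto (fun n : ℕ => Real.sqrt (n + 1) - Real.sqrt n) atTop (nhds 0) := by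
      refine tendsto_of_tendsto_of_tendsto_of_le_of_le' tendsto_const_nhds h3.inv_tendsto_atTop ?_ ?_
      · filter_upwards with n
        have : Real.sqrt n ≤ Real.sqrt (n + 1) := Real.sqrt_le_sqrt (by linarith)
        linarith
      · filter_upwards [h3.eventually_gt_atTop 0] with n hn
        have : Real.sqrt n ≤ Real.sqrt (n + 1) := Real.sqrt_le_sqrt (by linarith)
        have q1 : Real.sqrt ((n:ℝ) + 1) ^ 2 = n + 1 := Real.sq_sqrt (by positivity)
        have q2 : Real.sqrt (n:ℝ) ^ 2 = n := Real.sq_sqrt (by positivity)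
        rw [Pi.inv_apply, ← one_div, le_div_iff₀ hn]
        nlinarith
    simpa using h4.const_mul D
  have := h1.add h2
  rw [add_zero] at this
  refine this.congr (fun n => ?_)
  ring

theorem furstenberg_nth_asymp :
    Tendsto (fun n : ℕ =>
        ((Nat.nth (fun m : ℕ => ∃ j k : ℕ, m = 2 ^ j * 3 ^ k) n : ℝ)) /
          (Real.exp (Real.sqrt (2 * Real.log 2 * Real.log 3) * Real.sqrt n) / Real.sqrt 6))
      atTop (nhds 1) ∧
    Tendsto (fun n : ℕ =>
        Real.log (Nat.nth (fun m : ℕ => ∃ j k : ℕ, m = 2 ^ j * 3 ^ k) n : ℝ) /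
          (Real.sqrt (2 * Real.log 2 * Real.log 3) * Real.sqrt n))
      atTop (nhds 1) := by
  have ha : 0 < Real.log 2 := Real.log_pos (by norm_num)
  have hb : 0 < Real.log 3 := Real.log_pos (by norm_num)
  have hm := main_lim
  constructor
  · have h1 := (Real.continuous_exp.tendsto 0).comp hm
    rw [Real.exp_zero] at h1
    refine h1.congr (fun n => ?_)
    have hs1 : 0 < Nat.nth (fun m : ℕ => ∃ j k : ℕ, m = 2 ^ j * 3 ^ k) n := by
      obtain ⟨j, k, h⟩ := Nat.nth_mem_of_infinite inf23 n
      rw [h]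
      positivity
    have h6 : Real.exp ((Real.log 2 + Real.log 3) / 2) = Real.sqrt 6 := by
      rw [← Real.log_mul (by norm_num) (by norm_num), ← Real.log_sqrt (by norm_num),
        Real.exp_log (by positivity)]
      norm_num
    simp only [Function.comp]
    rw [Real.exp_add, Real.exp_sub, Real.exp_log (by exact_mod_cast hs1), h6]
    field_simp
  · have hD : 0 < Real.sqrt (2 * Real.log 2 * Real.log 3) := Real.sqrt_pos.2 (by positivity)
    have h3 : Tendsto (fun n : ℕ => Real.sqrt (2 * Real.log 2 * Real.log 3) * Real.sqrt n) atTop atTop :=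
      (Real.tendsto_sqrt_atTop.comp tendsto_natCast_atTop_atTop).const_mul_atTop hD
    have h4 := ((hm.sub_const ((Real.log 2 + Real.log 3) / 2)).div_atTop h3).add_const 1
    rw [zero_add] at h4
    refine h4.congr' ?_
    filter_upwards [h3.eventually_gt_atTop 0] with n hn
    rw [add_sub_cancel_right, sub_div, div_self hn.ne']
    ring
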